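/- arXiv:1202.1635 — 2 statements merged into one kernel-verified Lean document; each statement's English description precedes it below -/
import Mathlib

section
/- For any flow φ on a topological space X, the limit space equals the intersection of the maximal invariant subsets of the r-exterior sets, and likewise for the bar-limit: L^r(X) = ⋂_{E ∈ ε^r(X)} inv(E) and L̄^r(X) = ⋂_{E ∈ ε^r(X)} inv(closure(E)). -/
open Set

/-- An open subset `N` is r-exterior for the flow `φ` if for every point `x` there is
`t₀ ∈ ℝ` such that `φ t x ∈ N` for all `t ≥ t₀`. -/
def RExterior {X : Type*} [TopologicalSpace X] (φ : ℝ → X → X) (N : Set X) : Prop :=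
  IsOpen N ∧ ∀ x : X, ∃ t₀ : ℝ, ∀ t : ℝ, t₀ ≤ t → φ t x ∈ N

/-- The limit space `L^r(X)`: the intersection of all r-exterior open subsets. -/
def limitR {X : Type*} [TopologicalSpace X] (φ : ℝ → X → X) : Set X :=
  ⋂₀ {E : Set X | RExterior φ E}

/-- The bar-limit space `L̄^r(X)`. -/
def barLimitR {X : Type*} [TopologicalSpace X] (φ : ℝ → X → X) : Set X :=
  ⋂ E ∈ {E : Set X | RExterior φ E}, closure E

/-- The maximal invariant subset of `A`. -/
def invSet {X : Type*} (φ : ℝ → X → X) (A : Set X) : Set X :=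
  {p : X | p ∈ A ∧ ∀ t : ℝ, φ t p ∈ A}

/-- The preimage of an r-exterior set under a time-`t` map of the flow is r-exterior. -/
lemma RExterior.preimage {X : Type*} [TopologicalSpace X] {φ : ℝ → X → X} {E : Set X}
    (hE : RExterior φ E) (t : ℝ) (hcont : Continuous (φ t))
    (hadd : ∀ t s x, φ t (φ s x) = φ (t + s) x) : RExterior φ (φ t ⁻¹' E) := by
  refine ⟨hE.1.preimage hcont, fun x => ?_⟩
  obtain ⟨t₀, ht₀⟩ := hE.2 x
  refine ⟨t₀ - t, fun s hs => ?_⟩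
  rw [mem_preimage, hadd]
  exact ht₀ _ (by linarith)

/-- The limit space equals the intersection of the maximal invariant subsets of the
r-exterior sets, and the bar-limit equals the intersection of the maximal invariant
subsets of their closures. -/
theorem limitR_eq_iInter_inv {X : Type*} [TopologicalSpace X] (φ : ℝ → X → X)
    (hcont : Continuous fun p : ℝ × X => φ p.1 p.2)
    (h0 : ∀ x, φ 0 x = x)
    (hadd : ∀ t s x, φ t (φ s x) = φ (t + s) x) :
    (limitR φ = ⋂ E ∈ {E : Set X | RExterior φ E}, invSet φ E) ∧
    (barLimitR φ = ⋂ E ∈ {E : Set X | RExterior φ E}, invSet φ (closure E)) := by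
  have hφ (t : ℝ) : Continuous (φ t) := hcont.comp (Continuous.prodMk_right t)
  constructor
  · ext p
    simp only [limitR, invSet, mem_sInter, mem_iInter, mem_ofPred_eq]
    exact ⟨fun h E hE => ⟨h E hE, fun t => h _ (hE.preimage t (hφ t) hadd)⟩,
      fun h E hE => (h E hE).1⟩
  · ext p
    simp only [barLimitR, invSet, mem_iInter, mem_ofPred_eq]
    exact ⟨fun h E hE => ⟨h E hE, fun t =>
        (hφ t).closure_preimage_subset E (h _ (hE.preimage t (hφ t) hadd))⟩,
      fun h E hE => (h E hE).1⟩
end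

section
/- Let φ be a flow on a topological space X which is locally compact and regular. Then the bar-limit space equals the closure of the Ω^r-limit set: L̄^r(X) = closure(Ω^r(X)). -/
open Set

/-- The right limit set `ω^r(p) = ⋂_{t ≥ 0} closure {s·p : s ≥ t}`. -/
def omegaR {X : Type*} [TopologicalSpace X] (φ : ℝ → X → X) (p : X) : Set X :=
  ⋂ t ∈ Ici (0 : ℝ), closure ((fun s : ℝ => φ s p) '' Ici t)

/-- The `Ω^r`-limit set of the flow. -/
def OmegaR {X : Type*} [TopologicalSpace X] (φ : ℝ → X → X) : Set X :=
  ⋃ p : X, omegaR φ p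

/-- Every right limit set is contained in the closure of every r-exterior set. -/
theorem omegaR_subset_closure {X : Type*} [TopologicalSpace X] {φ : ℝ → X → X} {E : Set X}
    (hE : RExterior φ E) (p : X) : omegaR φ p ⊆ closure E := by
  intro y hy
  obtain ⟨t₀, ht₀⟩ := hE.2 p
  refine closure_mono ?_ (mem_iInter₂.1 hy (max t₀ 0) (le_max_right t₀ 0))
  rintro _ ⟨s, hs, rfl⟩
  exact ht₀ s ((le_max_left _ _).trans hs)

/-- A trajectory returning to a compact set at arbitrarily large times has a right limit point
in that set. -/
theorem exists_mem_omegaR_of_frequently {X : Type*} [TopologicalSpace X] {φ : ℝ → X → X}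
    {K : Set X} (hK : IsCompact K) {p : X} (hp : ∃ᶠ t in Filter.atTop, φ t p ∈ K) :
    ∃ y ∈ K, y ∈ omegaR φ p := by
  obtain ⟨y, hyK, hy⟩ := hK.exists_mapClusterPt_of_frequently hp
  refine ⟨y, hyK, mem_iInter₂.2 fun t _ => ?_⟩
  exact (hy.clusterPt.mono (Filter.le_principal_iff.2
    (Filter.image_mem_map (Filter.Ici_mem_atTop t)))).mem_closure

/-- The complement of a closed compact set disjoint from all right limit sets is r-exterior. -/
theorem rExterior_compl {X : Type*} [TopologicalSpace X] {φ : ℝ → X → X} {K : Set X}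
    (hK : IsCompact K) (hKc : IsClosed K) (hd : Disjoint K (OmegaR φ)) : RExterior φ Kᶜ := by
  refine ⟨hKc.isOpen_compl, fun x => Filter.eventually_atTop.1 ?_⟩
  by_contra h
  obtain ⟨y, hyK, hy⟩ := exists_mem_omegaR_of_frequently (φ := φ) (p := x) hK
    (by simpa [Filter.Frequently] using h)
  exact disjoint_left.1 hd hyK (mem_iUnion.2 ⟨x, hy⟩)

/-- On a locally compact regular space, `L̄^r(X) = closure (Ω^r(X))`. -/
theorem barLimitR_eq_closure_OmegaR {X : Type*} [TopologicalSpace X]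
    [LocallyCompactSpace X] [RegularSpace X] (φ : ℝ → X → X)
    (hcont : Continuous fun p : ℝ × X => φ p.1 p.2)
    (h0 : ∀ x, φ 0 x = x)
    (hadd : ∀ t s x, φ t (φ s x) = φ (t + s) x) :
    barLimitR φ = closure (OmegaR φ) := by
  apply Subset.antisymm
  · intro y hy
    by_contra hn
    obtain ⟨K, ⟨hKy, hK, hKc⟩, hKd⟩ := (isCompact_isClosed_basis_nhds y).mem_iff.1
      (isClosed_closure.isOpen_compl.mem_nhds hn)
    have hE : RExterior φ Kᶜ := rExterior_compl hK hKc
      (disjoint_left.2 fun z hz hzΩ => hKd hz (subset_closure hzΩ))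
    have hyE : y ∈ closure Kᶜ := mem_iInter₂.1 hy _ hE
    rw [closure_compl] at hyE
    exact hyE (mem_interior_iff_mem_nhds.2 hKy)
  · exact subset_iInter₂ fun E hE => closure_minimal
      (iUnion_subset (omegaR_subset_closure hE)) isClosed_closure
end
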